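/- Fix an n×n complex matrix A and δ > 0. Let E(ε) be a path of n×n complex matrices differentiable at ε₀ > 0, and for each i = 1,…,m let λᵢ(ε) ∈ ℂ, xᵢ(ε), yᵢ(ε) ∈ ℂⁿ be differentiable at ε₀ and satisfy, for all ε near ε₀: (A + εE(ε)) yᵢ(ε) = λᵢ(ε) yᵢ(ε), xᵢ(ε)* (A + εE(ε)) = λᵢ(ε) xᵢ(ε)*, ‖xᵢ(ε)‖ = ‖yᵢ(ε)‖ = 1, and xᵢ(ε)* yᵢ(ε) real and strictly positive. Define F(ε) = (1/2) Σᵢ₌₁^m ((Re λᵢ(ε) + δ)₊)² and G(ε) = Σᵢ₌₁^m γᵢ(ε) xᵢ(ε) yᵢ(ε)* with γᵢ(ε) = (Re λᵢ(ε) + δ)₊ / (xᵢ(ε)* yᵢ(ε)). Then F is differentiable at ε₀ and F'(ε₀) = Re⟨G(ε₀), E(ε₀) + ε₀ E'(ε₀)⟩. -/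

import Mathlib

open Matrix

/-- The Frobenius inner product `⟨X, Y⟩ = trace(X* Y)`. -/
noncomputable def frobInner {n : ℕ} (X Y : Matrix (Fin n) (Fin n) ℂ) : ℂ :=
  (Xᴴ * Y).trace

theorem hasDerivAt_sq_max_zero (t : ℝ) :
    HasDerivAt (fun s : ℝ => max s 0 ^ 2) (2 * max t 0) t := by
  rw [hasDerivAt_iff_isLittleO]
  have hO : (fun s : ℝ => max s 0 ^ 2 - max t 0 ^ 2 - (s - t) • (2 * max t 0))
      =O[nhds t] fun s => (s - t) ^ 2 := by
    refine Asymptotics.IsBigO.of_bound 1 (Filter.Eventually.of_forall fun s => ?_)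
    rw [one_mul, Real.norm_eq_abs, Real.norm_eq_abs, abs_of_nonneg (sq_nonneg (s - t)),
      smul_eq_mul, abs_le]
    rcases le_total s 0 with hs | hs <;> rcases le_total t 0 with ht | ht <;>
      simp only [max_eq_left, max_eq_right, hs, ht] <;> constructor <;> nlinarith
  simpa using hO.norm_right.trans_isLittleO
    (by simpa using Asymptotics.isLittleO_pow_sub_sub t one_lt_two)

/-- First-order perturbation of an eigenvalue along a path of matrices: pairing the
differentiated eigenvalue equation with a left eigenvector `w` eliminates the derivative of the
right eigenvector. -/
theorem dotProduct_mulVec_eq_of_hasDerivAt {n : Type*} [Fintype n]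
    {M : ℝ → Matrix n n ℂ} {M' : Matrix n n ℂ} {μ : ℝ → ℂ} {μ' : ℂ}
    {v : ℝ → n → ℂ} {v' w : n → ℂ} {t : ℝ}
    (hM : ∀ i j, HasDerivAt (fun s => M s i j) (M' i j) t) (hμ : HasDerivAt μ μ' t)
    (hv : ∀ k, HasDerivAt (fun s => v s k) (v' k) t)
    (hright : ∀ᶠ s in nhds t, M s *ᵥ v s = μ s • v s) (hleft : w ᵥ* M t = μ t • w) :
    w ⬝ᵥ M' *ᵥ v t = μ' * (w ⬝ᵥ v t) := by
  have key : M' *ᵥ v t + M t *ᵥ v' = μ' • v t + μ t • v' := by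
    ext k
    have h₁ : HasDerivAt (fun s => (M s *ᵥ v s) k) ((M' *ᵥ v t + M t *ᵥ v') k) t := by
      simp only [mulVec, dotProduct, Pi.add_apply, ← Finset.sum_add_distrib]
      exact HasDerivAt.fun_sum fun j _ => (hM k j).mul (hv j)
    have h₂ : HasDerivAt (fun s => (M s *ᵥ v s) k) ((μ' • v t + μ t • v') k) t :=
      (hμ.mul (hv k)).congr_of_eventuallyEq (hright.mono fun s hs => congrFun hs k)
    exact h₁.unique h₂
  have h := congrArg (w ⬝ᵥ ·) key
  simp only [dotProduct_add, dotProduct_smul, smul_eq_mul, dotProduct_mulVec w (M t), hleft,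
    smul_dotProduct] at h
  exact add_right_cancel h

theorem frobInner_sum_smul_vecMulVec {n : ℕ} {ι : Type*} (s : Finset ι) (c : ι → ℂ)
    (u v : ι → Fin n → ℂ) (B : Matrix (Fin n) (Fin n) ℂ) :
    frobInner (∑ i ∈ s, c i • vecMulVec (u i) (star (v i))) B =
      ∑ i ∈ s, star (c i) * (star (u i) ⬝ᵥ B *ᵥ v i) := by
  simp only [frobInner, conjTranspose_sum, conjTranspose_smul, conjTranspose_vecMulVec, star_star,
    Matrix.sum_mul, trace_sum, Matrix.smul_mul, trace_smul, smul_eq_mul, vecMulVec_mul,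
    trace_vecMulVec, dotProduct_mulVec]
  simp only [dotProduct_comm]

/-- **Outer-iteration derivative formula.** With eigentriples
`(λᵢ(ε), xᵢ(ε), yᵢ(ε))` of `A + ε E(ε)` differentiable at `ε₀`,
`F(ε) = (1/2) Σᵢ ((Re λᵢ(ε) + δ)₊)²` and
`G(ε) = Σᵢ γᵢ(ε) xᵢ(ε) yᵢ(ε)*`, `γᵢ = (Re λᵢ + δ)₊ / (xᵢ* yᵢ)`, one has
`F'(ε₀) = Re⟨G(ε₀), E(ε₀) + ε₀ E'(ε₀)⟩`. -/
theorem outer_iteration_derivative {n m : ℕ}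
    (A : Matrix (Fin n) (Fin n) ℂ) (δ : ℝ) (hδ : 0 < δ)
    (E : ℝ → Matrix (Fin n) (Fin n) ℂ) (E' : Matrix (Fin n) (Fin n) ℂ)
    (ε₀ : ℝ) (hε₀ : 0 < ε₀)
    (lam : Fin m → ℝ → ℂ) (lam' : Fin m → ℂ)
    (x y : Fin m → ℝ → Fin n → ℂ) (x' y' : Fin m → Fin n → ℂ)
    (hE : ∀ i j, HasDerivAt (fun ε => E ε i j) (E' i j) ε₀)
    (hlam : ∀ i, HasDerivAt (lam i) (lam' i) ε₀)
    (hx : ∀ i k, HasDerivAt (fun ε => x i ε k) (x' i k) ε₀)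
    (hy : ∀ i k, HasDerivAt (fun ε => y i ε k) (y' i k) ε₀)
    (heig : ∀ᶠ ε in nhds ε₀, ∀ i : Fin m,
      (A + ε • E ε) *ᵥ y i ε = lam i ε • y i ε ∧
      star (x i ε) ᵥ* (A + ε • E ε) = lam i ε • star (x i ε) ∧
      star (x i ε) ⬝ᵥ x i ε = 1 ∧ star (y i ε) ⬝ᵥ y i ε = 1 ∧
      (star (x i ε) ⬝ᵥ y i ε).im = 0 ∧ 0 < (star (x i ε) ⬝ᵥ y i ε).re) :
    HasDerivAt
      (fun ε => (1 / 2 : ℝ) * ∑ i : Fin m, (max ((lam i ε).re + δ) 0) ^ 2)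
      ((frobInner
        (∑ i : Fin m,
          (((max ((lam i ε₀).re + δ) 0 : ℝ) : ℂ) / (star (x i ε₀) ⬝ᵥ y i ε₀)) •
            vecMulVec (x i ε₀) (star (y i ε₀)))
        (E ε₀ + ε₀ • E')).re) ε₀ := by
  have h₀ := heig.self_of_nhds
  have hderiv : ∀ i, star (x i ε₀) ⬝ᵥ (E ε₀ + ε₀ • E') *ᵥ y i ε₀ =
      lam' i * (star (x i ε₀) ⬝ᵥ y i ε₀) := fun i => by
    refine dotProduct_mulVec_eq_of_hasDerivAt (M := fun ε => A + ε • E ε) (fun k l => ?_)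
      (hlam i) (hy i) (heig.mono fun ε h => (h i).1) (h₀ i).2.1
    simpa [add_comm] using ((hasDerivAt_id ε₀).smul (hE k l)).const_add (A k l)
  have hF := (HasDerivAt.fun_sum (u := Finset.univ) fun i _ =>
    (hasDerivAt_sq_max_zero ((lam i ε₀).re + δ)).comp ε₀
      ((Complex.reCLM.hasFDerivAt.comp_hasDerivAt ε₀ (hlam i)).add_const δ)).const_mul (1 / 2 : ℝ)
  refine hF.congr_deriv ?_
  rw [frobInner_sum_smul_vecMulVec, Complex.re_sum, Finset.mul_sum]
  refine Finset.sum_congr rfl fun i _ => ?_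
  obtain ⟨-, -, -, -, him, hre⟩ := h₀ i
  have hne : star (x i ε₀) ⬝ᵥ y i ε₀ ≠ 0 := fun h => by simp [h] at hre
  have hreal : star (star (x i ε₀) ⬝ᵥ y i ε₀) = star (x i ε₀) ⬝ᵥ y i ε₀ :=
    Complex.conj_eq_iff_im.mpr him
  have hcancel (a b : ℂ) : a / (star (x i ε₀) ⬝ᵥ y i ε₀) * (b * (star (x i ε₀) ⬝ᵥ y i ε₀)) =
      a * b := by
    field_simp
  rw [hderiv, star_div₀, hreal, Complex.star_def, Complex.conj_ofReal, hcancel,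
    Complex.re_ofReal_mul, Complex.reCLM_apply]
  ring
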